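/- Reduction of the leader's optimization to the finite-dimensional set (Proposition 1 analogue for one round): sSup (V^μ '' Π) = sSup (V^μ '' Π̂), i.e., the supremum of the leader's expected utility over all consistent signalings equals its supremum over consistent signalings supported on the finite set Ξ̂. -/

import Mathlib

open Finset Set

attribute [local instance] Classical.propDecidable

noncomputable section

variable {M N K : ℕ}

/-- The belief space `Ξ` is the standard simplex; the best-response region `Ξ[θ,j]` consists of
the beliefs under which `j` is a best response for the type-`θ` follower. -/
def XiBR (F : Fin K → Fin M → Fin N → ℝ) (θ : Fin K) (j : Fin N) : Set (Fin M → ℝ) :=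
  {b | b ∈ stdSimplex ℝ (Fin M) ∧ ∀ j' : Fin N, ∑ i, b i * F θ i j' ≤ ∑ i, b i * F θ i j}

/-- The region `Ξ[𝐣] = ⋂ θ, Ξ[θ, 𝐣 θ]`. -/
def XiT (F : Fin K → Fin M → Fin N → ℝ) (js : Fin K → Fin N) : Set (Fin M → ℝ) :=
  ⋂ θ : Fin K, XiBR F θ (js θ)

/-- The follower's value function `F̄ θ b = max_j ∑ i, b i * F θ i j`. -/
def Fbar (F : Fin K → Fin M → Fin N → ℝ) (θ : Fin K) (b : Fin M → ℝ) : ℝ :=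
  ⨆ j : Fin N, ∑ i, b i * F θ i j

/-- The leader's (leader-favored tie-broken) value function `V̄ θ b`: the maximum of
`∑ i, b i * L i j` over the follower best responses `j` at belief `b`. -/
def Vbar (L : Fin M → Fin N → ℝ) (F : Fin K → Fin M → Fin N → ℝ) (θ : Fin K)
    (b : Fin M → ℝ) : ℝ :=
  sSup ((fun j => ∑ i, b i * L i j) '' {j : Fin N | ∑ i, b i * F θ i j = Fbar F θ b})

/-- The set of beliefs `Ξ̂`: the union over tuples `𝐣` of the extreme points of `Ξ[𝐣]`. -/
def XiHat (F : Fin K → Fin M → Fin N → ℝ) : Set (Fin M → ℝ) :=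
  ⋃ js : Fin K → Fin N, Set.extremePoints ℝ (XiT F js)

/-- A signaling assigns to each type a nonnegative finitely supported weight function on
beliefs, supported in the simplex, of total mass one. -/
def IsSignaling (π : Fin K → ((Fin M → ℝ) →₀ ℝ)) : Prop :=
  ∀ θ : Fin K, (∀ b, 0 ≤ π θ b) ∧ (((π θ).support : Set (Fin M → ℝ)) ⊆ stdSimplex ℝ (Fin M)) ∧
    ∑ b ∈ (π θ).support, π θ b = 1

/-- Consistency: all types' expected posterior beliefs coincide. -/
def Consistent (π : Fin K → ((Fin M → ℝ) →₀ ℝ)) : Prop :=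
  ∀ θ θ' : Fin K, ∀ i : Fin M,
    ∑ b ∈ (π θ).support, π θ b * b i = ∑ b ∈ (π θ').support, π θ' b * b i

/-- The set `Π` of consistent signalings. -/
def SigSet (M K : ℕ) : Set (Fin K → ((Fin M → ℝ) →₀ ℝ)) :=
  {π | IsSignaling π ∧ Consistent π}

/-- The set `Π̂` of consistent signalings supported on `Ξ̂`. -/
def SigSetHat (F : Fin K → Fin M → Fin N → ℝ) : Set (Fin K → ((Fin M → ℝ) →₀ ℝ)) :=
  {π | π ∈ SigSet M K ∧ ∀ θ, ((π θ).support : Set (Fin M → ℝ)) ⊆ XiHat F}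

/-- The follower's expected utility `U π θ̂ θ`. -/
def Usig (F : Fin K → Fin M → Fin N → ℝ) (π : Fin K → ((Fin M → ℝ) →₀ ℝ))
    (θhat θ : Fin K) : ℝ :=
  ∑ b ∈ (π θhat).support, π θhat b * Fbar F θ b

/-- The leader's expected utility `V π θ̂ θ`. -/
def Vsig (L : Fin M → Fin N → ℝ) (F : Fin K → Fin M → Fin N → ℝ)
    (π : Fin K → ((Fin M → ℝ) →₀ ℝ)) (θhat θ : Fin K) : ℝ :=
  ∑ b ∈ (π θhat).support, π θhat b * Vbar L F θ b

/-- The follower's optimal reporting strategy `ψ θ π`: the least maximizer of `U π · θ`. -/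
def psi (F : Fin K → Fin M → Fin N → ℝ) (π : Fin K → ((Fin M → ℝ) →₀ ℝ)) (θ : Fin K) :
    Fin K :=
  if h : (Finset.univ.filter fun θhat => ∀ β, Usig F π β θ ≤ Usig F π θhat θ).Nonempty then
    (Finset.univ.filter fun θhat => ∀ β, Usig F π β θ ≤ Usig F π θhat θ).min' h
  else θ

/-- The leader's expected utility `V^μ` under prior `μ`. -/
def Vmu (L : Fin M → Fin N → ℝ) (F : Fin K → Fin M → Fin N → ℝ) (μ : Fin K → ℝ)
    (π : Fin K → ((Fin M → ℝ) →₀ ℝ)) : ℝ :=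
  ∑ θ, μ θ * Vsig L F π (psi F π θ) θ

/-- A polyhedron, i.e. the solution set of finitely many linear inequalities, has only finitely
many extreme points: an extreme point is determined by the set of inequalities tight at it. -/
theorem finite_extremePoints_polyhedron {ι E : Type*} [Finite ι] [AddCommGroup E] [Module ℝ E]
    (a : ι → E →ₗ[ℝ] ℝ) (r : ι → ℝ) :
    (Set.extremePoints ℝ {x | ∀ c, a c x ≤ r c}).Finite := by
  refine Set.Finite.of_finite_image (f := fun x => {c | a c x = r c}) (Set.toFinite _) ?_
  intro e he e' he' hee
  obtain ⟨heP, hext⟩ := mem_extremePoints_iff_left.1 he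
  have he'P : ∀ c, a c e' ≤ r c := he'.1
  have hev : ∀ᶠ t : ℝ in nhdsWithin 0 (Set.Ioi 0), ∀ c, a c (e + t • (e - e')) ≤ r c := by
    rw [Filter.eventually_all]
    intro c
    simp only [map_add, map_smul, map_sub, smul_eq_mul]
    rcases (heP c).lt_or_eq with hlt | heq
    · have hc : ContinuousAt (fun t : ℝ => a c e + t * (a c e - a c e')) 0 := by fun_prop
      have hlt' : a c e + 0 * (a c e - a c e') < r c := by simpa using hlt
      have h := hc.eventually_lt_const hlt'
      exact (h.filter_mono nhdsWithin_le_nhds).mono fun t ht => ht.le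
    · have heq' : a c e' = r c := (Set.ext_iff.1 hee c).1 heq
      simp [heq, heq']
  obtain ⟨t, ht, ht0⟩ := (hev.and self_mem_nhdsWithin).exists
  have ht0 : 0 < t := ht0
  have hne : t + 1 ≠ 0 := by positivity
  refine (hext e' he'P _ ht ⟨t / (t + 1), 1 / (t + 1), by positivity, by positivity,
    by field_simp, ?_⟩).symm
  have h1 : t / (t + 1) = 1 - 1 / (t + 1) := by field_simp; ring
  have h2 : 1 / (t + 1) * t = 1 - 1 / (t + 1) := by field_simp; ring
  rw [smul_add, smul_smul, h2, h1]
  module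

theorem XiT_subset_stdSimplex (hK : 0 < K) (F : Fin K → Fin M → Fin N → ℝ) (js : Fin K → Fin N) :
    XiT F js ⊆ stdSimplex ℝ (Fin M) :=
  fun _ hb => (Set.mem_iInter.1 hb ⟨0, hK⟩).1

theorem XiHat_subset_stdSimplex (hK : 0 < K) (F : Fin K → Fin M → Fin N → ℝ) :
    XiHat F ⊆ stdSimplex ℝ (Fin M) :=
  Set.iUnion_subset fun js => extremePoints_subset.trans (XiT_subset_stdSimplex hK F js)

theorem finite_extremePoints_XiT (hK : 0 < K) (F : Fin K → Fin M → Fin N → ℝ)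
    (js : Fin K → Fin N) : (Set.extremePoints ℝ (XiT F js)).Finite := by
  let total : (Fin M → ℝ) →ₗ[ℝ] ℝ := ∑ i, LinearMap.proj i
  let a : Fin M ⊕ Bool ⊕ (Fin K × Fin N) → (Fin M → ℝ) →ₗ[ℝ] ℝ :=
    Sum.elim (fun i => -LinearMap.proj i) (Sum.elim (fun s => bif s then total else -total)
      (fun p => ∑ i, (F p.1 i p.2 - F p.1 i (js p.1)) • LinearMap.proj i))
  let r : Fin M ⊕ Bool ⊕ (Fin K × Fin N) → ℝ :=
    Sum.elim (fun _ => 0) (Sum.elim (fun s => bif s then 1 else -1) (fun _ => 0))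
  suffices heq : XiT F js = {x | ∀ c, a c x ≤ r c} from
    heq ▸ finite_extremePoints_polyhedron a r
  ext b
  have hBR : ∀ (θ : Fin K) (j : Fin N),
      (∑ i, (F θ i j - F θ i (js θ)) * b i ≤ 0 ↔
        ∑ i, b i * F θ i j ≤ ∑ i, b i * F θ i (js θ)) := by
    intro θ j
    rw [← sub_nonpos (a := ∑ i, b i * F θ i j), ← Finset.sum_sub_distrib]
    simp only [sub_mul, mul_comm (b _)]
  have : Nonempty (Fin K) := ⟨⟨0, hK⟩⟩
  simp only [XiT, XiBR, stdSimplex, Set.mem_iInter, Set.mem_ofPred_eq, Sum.forall, Bool.forall_bool,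
    Prod.forall, a, r, total, Sum.elim_inl, Sum.elim_inr, cond_true, cond_false, LinearMap.neg_apply,
    LinearMap.sum_apply, LinearMap.smul_apply, LinearMap.proj_apply, smul_eq_mul, hBR,
    neg_nonpos, neg_le_neg_iff, forall_and, forall_const, and_assoc]
  rw [and_congr_right_iff]
  intro _
  rw [← and_assoc, and_congr_left_iff]
  intro _
  constructor
  · intro h; exact ⟨h.ge, h.le⟩
  · rintro ⟨h, h'⟩; exact le_antisymm h' h

theorem convex_XiT (F : Fin K → Fin M → Fin N → ℝ) (js : Fin K → Fin N) :
    Convex ℝ (XiT F js) := by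
  refine convex_iInter fun θ => (convex_stdSimplex ℝ (Fin M)).inter ?_
  intro x hx y hy s t hs ht _ j
  have h1 := mul_le_mul_of_nonneg_left (hx j) hs
  have h2 := mul_le_mul_of_nonneg_left (hy j) ht
  simp only [Pi.add_apply, Pi.smul_apply, smul_eq_mul, add_mul, mul_assoc, Finset.sum_add_distrib,
    ← Finset.mul_sum]
  exact add_le_add h1 h2

theorem isCompact_XiT (hK : 0 < K) (F : Fin K → Fin M → Fin N → ℝ) (js : Fin K → Fin N) :
    IsCompact (XiT F js) := by
  refine (isCompact_stdSimplex ℝ (Fin M)).of_isClosed_subset ?_ (XiT_subset_stdSimplex hK F js)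
  refine isClosed_iInter fun θ => ?_
  have heq : XiBR F θ (js θ) = stdSimplex ℝ (Fin M) ∩
      ⋂ j, {b | ∑ i, b i * F θ i j ≤ ∑ i, b i * F θ i (js θ)} := by
    ext b
    simp [XiBR]
  rw [heq]
  exact (isClosed_stdSimplex ℝ (Fin M)).inter <|
    isClosed_iInter fun j => isClosed_le (by fun_prop) (by fun_prop)

/-- Every belief of `Ξ[𝐣]` is the mean of a finitely supported distribution on the extreme points
of `Ξ[𝐣]`. -/
theorem exists_distribution_extremePoints (hK : 0 < K) (F : Fin K → Fin M → Fin N → ℝ)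
    (js : Fin K → Fin N) {b : Fin M → ℝ} (hb : b ∈ XiT F js) :
    ∃ w : (Fin M → ℝ) →₀ ℝ, (∀ y, 0 ≤ w y) ∧
      (w.support : Set (Fin M → ℝ)) ⊆ Set.extremePoints ℝ (XiT F js) ∧
      Finsupp.linearCombination ℝ (fun _ => (1 : ℝ)) w = 1 ∧
      Finsupp.linearCombination ℝ id w = b := by
  have hfin := finite_extremePoints_XiT hK F js
  rw [← closure_convexHull_extremePoints (isCompact_XiT hK F js) (convex_XiT F js),
    (hfin.isCompact_convexHull ℝ).isClosed.closure_eq, ← hfin.coe_toFinset,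
    Finset.mem_convexHull'] at hb
  obtain ⟨w, hw0, hw1, hwb⟩ := hb
  have hsupp : ((Finsupp.indicator hfin.toFinset fun y _ => w y).support : Set (Fin M → ℝ)) ⊆
      hfin.toFinset := Finset.coe_subset.2 (Finsupp.support_indicator_subset _ _)
  refine ⟨Finsupp.indicator hfin.toFinset fun y _ => w y, fun y => ?_, ?_, ?_, ?_⟩
  · rw [Finsupp.indicator_apply]
    split_ifs with hy
    exacts [hw0 y hy, le_rfl]
  · rwa [hfin.coe_toFinset] at hsupp
  · rw [Finsupp.linearCombination_apply, Finsupp.sum_of_support_subset _ hsupp _ (by simp)]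
    refine (Finset.sum_congr rfl fun y hy => ?_).trans hw1
    rw [Finsupp.indicator_of_mem hy, smul_eq_mul, mul_one]
  · rw [Finsupp.linearCombination_apply, Finsupp.sum_of_support_subset _ hsupp _ (by simp), ← hwb]
    exact Finset.sum_congr rfl fun y hy => by rw [Finsupp.indicator_of_mem hy, id]

theorem Fbar_eq_iff (F : Fin K → Fin M → Fin N → ℝ) (θ : Fin K) (b : Fin M → ℝ) (j : Fin N) :
    ∑ i, b i * F θ i j = Fbar F θ b ↔ ∀ j', ∑ i, b i * F θ i j' ≤ ∑ i, b i * F θ i j := by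
  have hbdd : BddAbove (Set.range fun j => ∑ i, b i * F θ i j) := (Set.finite_range _).bddAbove
  have : Nonempty (Fin N) := ⟨j⟩
  exact ⟨fun h j' => h ▸ le_ciSup hbdd j', fun h => le_antisymm (le_ciSup hbdd j) (ciSup_le h)⟩

theorem le_Vbar (L : Fin M → Fin N → ℝ) (F : Fin K → Fin M → Fin N → ℝ) {θ : Fin K}
    {b : Fin M → ℝ} {j : Fin N} (hj : ∑ i, b i * F θ i j = Fbar F θ b) :
    ∑ i, b i * L i j ≤ Vbar L F θ b :=
  le_csSup (Set.toFinite _).bddAbove (Set.mem_image_of_mem _ hj)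

/-- The leader's value is attained at some best response of the follower. -/
theorem exists_eq_Vbar (hN : 0 < N) (L : Fin M → Fin N → ℝ) (F : Fin K → Fin M → Fin N → ℝ)
    (θ : Fin K) (b : Fin M → ℝ) :
    ∃ j, ∑ i, b i * F θ i j = Fbar F θ b ∧ ∑ i, b i * L i j = Vbar L F θ b := by
  have : Nonempty (Fin N) := ⟨⟨0, hN⟩⟩
  obtain ⟨j, hj⟩ := Finite.exists_max fun j => ∑ i, b i * F θ i j
  have hne : {j : Fin N | ∑ i, b i * F θ i j = Fbar F θ b}.Nonempty :=
    ⟨j, (Fbar_eq_iff F θ b j).2 hj⟩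
  exact (hne.image _).csSup_mem (Set.toFinite _)

theorem linearCombination_real_mono {α : Type*} {w : α →₀ ℝ} (hw : ∀ y, 0 ≤ w y) {f g : α → ℝ}
    (h : ∀ y ∈ w.support, f y ≤ g y) :
    Finsupp.linearCombination ℝ f w ≤ Finsupp.linearCombination ℝ g w :=
  Finset.sum_le_sum fun y hy => mul_le_mul_of_nonneg_left (h y hy) (hw y)

/-- Averaging a linear functional over a distribution evaluates it at the mean. -/
theorem linearCombination_sum_mul {w : (Fin M → ℝ) →₀ ℝ} {b : Fin M → ℝ}
    (hw : Finsupp.linearCombination ℝ id w = b) (c : Fin M → ℝ) :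
    Finsupp.linearCombination ℝ (fun y : Fin M → ℝ => ∑ i, y i * c i) w = ∑ i, b i * c i := by
  let ℓ : (Fin M → ℝ) →ₗ[ℝ] ℝ := ∑ i, c i • LinearMap.proj i
  have hℓ : ∀ y : Fin M → ℝ, ∑ i, y i * c i = ℓ y := by
    intro y
    simp [ℓ, LinearMap.sum_apply, mul_comm]
  rw [hℓ b, ← hw, Finsupp.apply_linearCombination]
  congr 2
  exact funext hℓ

/-- Every belief can be split into beliefs of `Ξ̂`, keeping the followers' values and not lowering
the leader's values. -/
theorem exists_splitting (hN : 0 < N) (hK : 0 < K) (L : Fin M → Fin N → ℝ)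
    (F : Fin K → Fin M → Fin N → ℝ) {b : Fin M → ℝ} (hb : b ∈ stdSimplex ℝ (Fin M)) :
    ∃ w : (Fin M → ℝ) →₀ ℝ, (∀ y, 0 ≤ w y) ∧ w ∈ Finsupp.supported ℝ ℝ (XiHat F) ∧
      Finsupp.linearCombination ℝ (fun _ => (1 : ℝ)) w = 1 ∧
      (∀ i, Finsupp.linearCombination ℝ (fun y => y i) w = b i) ∧
      (∀ θ, Finsupp.linearCombination ℝ (Fbar F θ) w = Fbar F θ b) ∧
      ∀ θ, Vbar L F θ b ≤ Finsupp.linearCombination ℝ (Vbar L F θ) w := by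
  choose js hF hL using fun θ => exists_eq_Vbar hN L F θ b
  obtain ⟨w, hw0, hws, hw1, hwb⟩ := exists_distribution_extremePoints hK F js
    (Set.mem_iInter.2 fun θ => ⟨hb, (Fbar_eq_iff F θ b (js θ)).1 (hF θ)⟩)
  have hbest : ∀ θ, ∀ y ∈ w.support, ∑ i, y i * F θ i (js θ) = Fbar F θ y := fun θ y hy =>
    (Fbar_eq_iff F θ y (js θ)).2 (Set.mem_iInter.1 (extremePoints_subset (hws hy)) θ).2
  refine ⟨w, hw0, (Finsupp.mem_supported ℝ w).2 fun y hy => Set.mem_iUnion.2 ⟨js, hws hy⟩, hw1,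
    fun i => ?_, fun θ => ?_, fun θ => ?_⟩
  · simpa [Pi.single_apply] using linearCombination_sum_mul hwb (Pi.single i 1)
  · rw [← hF θ, ← linearCombination_sum_mul hwb]
    exact Finset.sum_congr rfl fun y hy => by simp only [hbest θ y hy]
  · rw [← hL θ, ← linearCombination_sum_mul hwb]
    exact linearCombination_real_mono hw0 fun y hy => le_Vbar L F (hbest θ y hy)

theorem Usig_eq_linearCombination (F : Fin K → Fin M → Fin N → ℝ)
    (π : Fin K → ((Fin M → ℝ) →₀ ℝ)) (θhat θ : Fin K) :
    Usig F π θhat θ = Finsupp.linearCombination ℝ (Fbar F θ) (π θhat) := rfl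

theorem Vsig_eq_linearCombination (L : Fin M → Fin N → ℝ) (F : Fin K → Fin M → Fin N → ℝ)
    (π : Fin K → ((Fin M → ℝ) →₀ ℝ)) (θhat θ : Fin K) :
    Vsig L F π θhat θ = Finsupp.linearCombination ℝ (Vbar L F θ) (π θhat) := rfl

/-- Every consistent signaling is weakly dominated by one supported on `Ξ̂`. -/
theorem exists_mem_SigSetHat_Vmu_le (hN : 0 < N) (hK : 0 < K) (L : Fin M → Fin N → ℝ)
    (F : Fin K → Fin M → Fin N → ℝ) (μ : Fin K → ℝ) (hμ : ∀ θ, 0 ≤ μ θ)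
    {π : Fin K → ((Fin M → ℝ) →₀ ℝ)} (hπ : π ∈ SigSet M K) :
    ∃ π' ∈ SigSetHat F, Vmu L F μ π ≤ Vmu L F μ π' := by
  obtain ⟨hsig, hcons⟩ := hπ
  choose! W hW0 hWs hW1 hWb hWF hWV using
    fun b (hb : b ∈ stdSimplex ℝ (Fin M)) => exists_splitting hN hK L F hb
  have hmem : ∀ θ, ∀ b ∈ (π θ).support, b ∈ stdSimplex ℝ (Fin M) :=
    fun θ b hb => (hsig θ).2.1 hb
  let π' : Fin K → ((Fin M → ℝ) →₀ ℝ) := fun θ => Finsupp.linearCombination ℝ W (π θ)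
  have hcomp : ∀ (f : (Fin M → ℝ) → ℝ) (θ : Fin K), Finsupp.linearCombination ℝ f (π' θ) =
      Finsupp.linearCombination ℝ (fun b => Finsupp.linearCombination ℝ f (W b)) (π θ) :=
    fun f θ => Finsupp.apply_linearCombination ℝ (Finsupp.linearCombination ℝ f) W (π θ)
  have hcongr : ∀ (f g : (Fin M → ℝ) → ℝ),
      (∀ b ∈ stdSimplex ℝ (Fin M), Finsupp.linearCombination ℝ f (W b) = g b) →
      ∀ θ, Finsupp.linearCombination ℝ f (π' θ) = Finsupp.linearCombination ℝ g (π θ) := by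
    intro f g h θ
    rw [hcomp]
    exact Finset.sum_congr rfl fun b hb => by simp only [h b (hmem θ b hb)]
  have hsupp : ∀ θ, ((π' θ).support : Set (Fin M → ℝ)) ⊆ XiHat F := fun θ =>
    (Finsupp.mem_supported ℝ _).1 <| Submodule.sum_mem _ fun b hb =>
      Submodule.smul_mem _ _ (hWs b (hmem θ b hb))
  have hone : ∀ p : (Fin M → ℝ) →₀ ℝ,
      ∑ b ∈ p.support, p b = Finsupp.linearCombination ℝ (fun _ => (1 : ℝ)) p := fun p => by
    simp [Finsupp.linearCombination_apply, Finsupp.sum]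
  have hU : Usig F π' = Usig F π := funext fun θhat => funext fun θ =>
    hcongr _ _ (fun b hb => hWF b hb θ) θhat
  have hV : ∀ θhat θ, Vsig L F π θhat θ ≤ Vsig L F π' θhat θ := fun θhat θ => by
    rw [Vsig_eq_linearCombination, Vsig_eq_linearCombination, hcomp]
    exact linearCombination_real_mono (hsig θhat).1 fun b hb => hWV b (hmem θhat b hb) θ
  refine ⟨π', ⟨⟨fun θ => ⟨fun y => ?_, (hsupp θ).trans (XiHat_subset_stdSimplex hK F), ?_⟩,
    fun θ θ' i => ?_⟩, hsupp⟩, ?_⟩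
  · simp only [π', Finsupp.linearCombination_apply, Finsupp.sum, Finsupp.finsetSum_apply]
    exact Finset.sum_nonneg fun b hb => mul_nonneg ((hsig θ).1 b) (hW0 b (hmem θ b hb) y)
  · rw [hone, hcongr _ _ hW1, ← hone]
    exact (hsig θ).2.2
  · have hmean := hcongr (fun y => y i) (fun y => y i) fun b hb => hWb b hb i
    exact (hmean θ).trans ((hcons θ θ' i).trans (hmean θ').symm)
  · have hpsi : psi F π' = psi F π := funext fun θ => by simp only [psi, hU]
    rw [Vmu, Vmu, hpsi]
    exact Finset.sum_le_sum fun θ _ => mul_le_mul_of_nonneg_left (hV _ _) (hμ θ)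

/-- the supremum of the leader's expected utility over all consistent
signalings equals its supremum over consistent signalings supported on `Ξ̂`. -/
theorem sSup_Vmu_eq_sSup_Vmu_hat (M N K : ℕ) (hM : 0 < M) (hN : 0 < N) (hK : 0 < K)
    (L : Fin M → Fin N → ℝ) (F : Fin K → Fin M → Fin N → ℝ)
    (μ : Fin K → ℝ) (hμ0 : ∀ θ, 0 ≤ μ θ) (hμ1 : ∑ θ, μ θ = 1) :
    sSup (Vmu L F μ '' SigSet M K) = sSup (Vmu L F μ '' SigSetHat F) := by
  refine csSup_eq_csSup_of_forall_exists_le ?_ ?_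
  · rintro _ ⟨π, hπ, rfl⟩
    obtain ⟨π', hπ', hle⟩ := exists_mem_SigSetHat_Vmu_le hN hK L F μ hμ0 hπ
    exact ⟨_, Set.mem_image_of_mem _ hπ', hle⟩
  · rintro _ ⟨π, hπ, rfl⟩
    exact ⟨_, Set.mem_image_of_mem _ hπ.1, le_rfl⟩

end
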